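/- arXiv:0803.4418 — 5 statements merged into one kernel-verified Lean document; each statement's English description precedes it below -/
import Mathlib

section
/- There is exactly one real number t > 0 satisfying t = exp((27³/(6·256³)) · (1 + 59/(512t))⁹). This t satisfies 1.0005 < t < 1.0006, and the number ρ := 27/(256 t³) satisfies 0.10530 < ρ < 0.10531; in particular ρ < 27/256. -/
/-- The exponent is antitone on the positive reals, so the fixed-point map is too. -/
theorem exp_fixed_map_antitoneOn :
    AntitoneOn
      (fun t : ℝ => Real.exp ((27 ^ 3 / (6 * 256 ^ 3)) * (1 + 59 / (512 * t)) ^ 9))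
      (Set.Ioi 0) := by
  intro a ha b hb hab
  have ha' : (0 : ℝ) < a := ha
  have hb' : (0 : ℝ) < b := hb
  dsimp only
  gcongr

theorem lower_lt_exp_fixed_map :
    (1.00052 : ℝ) <
      Real.exp ((27 ^ 3 / (6 * 256 ^ 3)) * (1 + 59 / (512 * 1.00052)) ^ 9) := by
  refine lt_of_lt_of_le ?_ (Real.add_one_le_exp _)
  norm_num

theorem exp_fixed_map_lt_upper :
    Real.exp ((27 ^ 3 / (6 * 256 ^ 3)) * (1 + 59 / (512 * 1.00053)) ^ 9) <
      (1.00053 : ℝ) := by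
  have hx : (27 ^ 3 / (6 * 256 ^ 3)) * (1 + 59 / (512 * 1.00053)) ^ 9 < (0.000522 : ℝ) := by
    norm_num
  have h := Real.exp_bound_div_one_sub_of_interval (x := 0.000522) (by norm_num) (by norm_num)
  refine (Real.exp_lt_exp.2 hx).trans_le (h.trans ?_)
  norm_num

theorem unique_fixed_point_F0 :
    (∃! t : ℝ, 0 < t ∧
        t = Real.exp ((27 ^ 3 / (6 * 256 ^ 3)) * (1 + 59 / (512 * t)) ^ 9)) ∧
    ∀ t : ℝ, 0 < t →
      t = Real.exp ((27 ^ 3 / (6 * 256 ^ 3)) * (1 + 59 / (512 * t)) ^ 9) →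
        (1.0005 < t ∧ t < 1.0006) ∧
        (0.10530 < 27 / (256 * t ^ 3) ∧ 27 / (256 * t ^ 3) < 0.10531) ∧
        27 / (256 * t ^ 3) < 27 / 256 := by
  have hanti := exp_fixed_map_antitoneOn
  have hl := lower_lt_exp_fixed_map
  have hu := exp_fixed_map_lt_upper
  refine ⟨?_, ?_⟩
  · have hcont : ContinuousOn
        (fun t : ℝ => t - Real.exp ((27 ^ 3 / (6 * 256 ^ 3)) * (1 + 59 / (512 * t)) ^ 9))
        (Set.Icc 1.00052 1.00053) := by
      intro t ht
      have ht0 : 512 * t ≠ 0 := by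
        have := ht.1
        norm_num at this ⊢
        linarith
      exact ContinuousAt.continuousWithinAt (by fun_prop (disch := assumption))
    obtain ⟨t, ht, hfix⟩ := intermediate_value_Icc (by norm_num) hcont
      (show (0 : ℝ) ∈ Set.Icc _ _ from ⟨(sub_neg.2 hl).le, (sub_pos.2 hu).le⟩)
    have ht0 : 0 < t := lt_of_lt_of_le (by norm_num) ht.1
    have hfix' := sub_eq_zero.1 hfix
    refine ⟨t, ⟨ht0, hfix'⟩, ?_⟩
    rintro s ⟨hs0, hs⟩
    rcases le_total s t with hst | hts
    · have := hanti hs0 ht0 hst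
      exact le_antisymm hst (hfix'.le.trans (this.trans hs.ge))
    · have := hanti ht0 hs0 hts
      exact le_antisymm (hs.le.trans (this.trans hfix'.ge)) hts
  · intro t ht0 hfix
    have hlt : 1.00052 < t := by
      by_contra! h
      have := hanti ht0 (show (0 : ℝ) < 1.00052 by norm_num) h
      exact (hl.trans_le (this.trans hfix.ge)).not_ge h
    have htu : t < 1.00053 := by
      by_contra! h
      have := hanti (show (0 : ℝ) < 1.00053 by norm_num) ht0 h
      exact ((hfix.le.trans this).trans_lt hu).not_ge h
    have hcl : (1.00052 : ℝ) ^ 3 < t ^ 3 := by gcongr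
    have hcu : t ^ 3 < (1.00053 : ℝ) ^ 3 := by gcongr
    have hpos : 0 < 256 * t ^ 3 := by positivity
    norm_num at hlt htu hcl hcu
    refine ⟨⟨?_, ?_⟩, ⟨?_, ?_⟩, ?_⟩
    · norm_num
      linarith
    · norm_num
      linarith
    · rw [lt_div_iff₀ hpos]
      norm_num
      linarith
    · rw [div_lt_iff₀ hpos]
      norm_num
      linarith
    · rw [div_lt_iff₀ hpos]
      linarith
end

section
/- Define Ψ(x,F,L) = (3/1024) · (−3L² + 3L + 2F + 3xF³) · x³ · (2F + xF³ + L − 2L²)⁸ − 1 for real x, F, L. Then: (i) for every fixed F ≥ 1 and L ∈ [0,1/4], the function x ↦ Ψ(x,F,L) is monotone nondecreasing on [0,∞); (ii) for every fixed x > 0 and L ∈ [0,1/4], the function F ↦ Ψ(x,F,L) is strictly increasing on [1,∞); (iii) for every fixed x > 0 and F ≥ 1, the function L ↦ Ψ(x,F,L) is strictly increasing on [0,1/4]. -/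
/-- The partial derivative `∂Φ/∂F` of the functional equation for edge-rooted maximal
`K_{3,3}`-minor-free graphs, expressed through the algebraic function `L`. -/
noncomputable def Psi (x F L : ℝ) : ℝ :=
  (3 / 1024) * (-3 * L ^ 2 + 3 * L + 2 * F + 3 * x * F ^ 3) * x ^ 3 *
    (2 * F + x * F ^ 3 + L - 2 * L ^ 2) ^ 8 - 1

theorem linear_factor_pos {x F L : ℝ} (hx : 0 ≤ x) (hF : 1 ≤ F)
    (hL : L ∈ Set.Icc (0 : ℝ) (1 / 4)) : 0 < -3 * L ^ 2 + 3 * L + 2 * F + 3 * x * F ^ 3 := by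
  have h₁ : 0 ≤ x * F ^ 3 := by positivity
  nlinarith [mul_nonneg hL.1 (sub_nonneg.2 hL.2), hL.1]

theorem power_base_pos {x F L : ℝ} (hx : 0 ≤ x) (hF : 1 ≤ F)
    (hL : L ∈ Set.Icc (0 : ℝ) (1 / 4)) : 0 < 2 * F + x * F ^ 3 + L - 2 * L ^ 2 := by
  have h₁ : 0 ≤ x * F ^ 3 := by positivity
  nlinarith [mul_nonneg hL.1 (sub_nonneg.2 hL.2), hL.1]

theorem Psi_lt_Psi {x F F' L L' : ℝ} (hx : 0 < x) (hF : 1 ≤ F)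
    (hL : L ∈ Set.Icc (0 : ℝ) (1 / 4))
    (hA : -3 * L ^ 2 + 3 * L + 2 * F + 3 * x * F ^ 3 <
      -3 * L' ^ 2 + 3 * L' + 2 * F' + 3 * x * F' ^ 3)
    (hB : 2 * F + x * F ^ 3 + L - 2 * L ^ 2 ≤ 2 * F' + x * F' ^ 3 + L' - 2 * L' ^ 2) :
    Psi x F L < Psi x F' L' := by
  have hA₀ := linear_factor_pos hx.le hF hL
  have hB₀ := power_base_pos hx.le hF hL
  refine sub_lt_sub_right ?_ 1
  refine mul_lt_mul ?_ (pow_le_pow_left₀ hB₀.le hB 8) (by positivity) ?_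
  · gcongr
  · have := hA₀.trans hA
    positivity

theorem Psi_monotone :
    (∀ F L : ℝ, 1 ≤ F → L ∈ Set.Icc (0 : ℝ) (1 / 4) →
      MonotoneOn (fun x => Psi x F L) (Set.Ici (0 : ℝ))) ∧
    (∀ x L : ℝ, 0 < x → L ∈ Set.Icc (0 : ℝ) (1 / 4) →
      StrictMonoOn (fun F => Psi x F L) (Set.Ici (1 : ℝ))) ∧
    (∀ x F : ℝ, 0 < x → 1 ≤ F →
      StrictMonoOn (fun L => Psi x F L) (Set.Icc (0 : ℝ) (1 / 4))) := by
  refine ⟨?_, ?_, ?_⟩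
  · intro F L hF hL x hx x' hx' hle
    have hx₀ : 0 ≤ x := hx
    have hx₀' : 0 ≤ x' := hx'
    have hA₀ := linear_factor_pos hx₀ hF hL
    have hA₀' := linear_factor_pos hx₀' hF hL
    have hB₀ := power_base_pos hx₀ hF hL
    have hpow : x * F ^ 3 ≤ x' * F ^ 3 := by gcongr
    refine sub_le_sub_right ?_ 1
    refine mul_le_mul ?_ (pow_le_pow_left₀ hB₀.le (by linarith) 8) (by positivity) (by positivity)
    gcongr
  · intro x L hx hL F hF F' _ hlt
    have hF₁ : 1 ≤ F := hF
    have hpow : x * F ^ 3 ≤ x * F' ^ 3 := by gcongr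
    exact Psi_lt_Psi hx hF₁ hL (by linarith) (by linarith)
  · intro x F hx hF L hL L' hL' hlt
    have hsum : L + L' ≤ 1 / 2 := by linarith [hL.2, hL'.2]
    have hprod := mul_nonneg (sub_nonneg.2 hlt.le) (sub_nonneg.2 hsum)
    exact Psi_lt_Psi hx hF hL (by nlinarith) (by nlinarith)
end

section
/- Let t* > 0 be the unique real number satisfying t* = exp((27³/(6·256³)) · (1 + 59/(512 t*))⁹), and set ρ = 27/(256 t*³). Then for every x with 0 < x ≤ ρ, there is exactly one real number F ∈ [1, t*] satisfying F = exp((x³/6) · (F + T₀(x,F))⁹); for such F one automatically has x F³ ≤ 27/256, so T₀(x,F) is well defined. -/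
/-- `φ(u) = u(1-u)³`. -/
noncomputable def phiTri (u : ℝ) : ℝ := u * (1 - u) ^ 3

/-- `θ` is the inverse of the restriction of `φ(u) = u(1-u)³` to `[0, 1/4]`,
which is a strictly increasing bijection onto `[0, 27/256]`. -/
noncomputable def thetaTri (x : ℝ) : ℝ :=
  Function.invFunOn phiTri (Set.Icc 0 (1 / 4)) x

/-- `T₀(x,u) = x u³/2 + θ(x u³)(1 − 2 θ(x u³))/2`, the generating function of
edge-rooted planar triangulations. -/
noncomputable def T0 (x u : ℝ) : ℝ :=
  x * u ^ 3 / 2 + thetaTri (x * u ^ 3) * (1 - 2 * thetaTri (x * u ^ 3)) / 2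

theorem phiTri_sub_le {a b : ℝ} (ha : 0 ≤ a) (hab : a ≤ b) (hb : b ≤ 1 / 4) :
    (b - 2 * b ^ 2) - (a - 2 * a ^ 2) ≤ 2 * (phiTri b - phiTri a) := by
  have hQ : 0 ≤ 1 - 4 * (a + b) + 6 * (a ^ 2 + a * b + b ^ 2)
      - 2 * (a ^ 3 + a ^ 2 * b + a * b ^ 2 + b ^ 3) := by
    obtain ⟨p, rfl⟩ : ∃ p, a = 1 / 4 - p := ⟨1 / 4 - a, by ring⟩
    obtain ⟨q, rfl⟩ : ∃ q, b = 1 / 4 - q := ⟨1 / 4 - b, by ring⟩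
    have hp : p ≤ 1 / 4 := by linarith
    have hq : 0 ≤ q := by linarith
    have hqp : q ≤ p := by linarith
    have hp0 : 0 ≤ p := hq.trans hqp
    nlinarith [mul_nonneg hp0 hq, mul_nonneg hp0 hp0, mul_nonneg hq hq, pow_nonneg hp0 3,
      pow_nonneg hq 3, mul_nonneg (pow_nonneg hp0 2) hq, mul_nonneg hp0 (pow_nonneg hq 2)]
  have h := mul_nonneg (sub_nonneg.2 hab) hQ
  unfold phiTri
  nlinarith

theorem strictMonoOn_phiTri : StrictMonoOn phiTri (Set.Icc 0 (1 / 4)) := by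
  intro a ha b hb hab
  have h := phiTri_sub_le ha.1 hab.le hb.2
  have h' : 0 < (b - a) * (1 - 2 * (a + b)) :=
    mul_pos (sub_pos.2 hab) (by linarith [hb.2])
  nlinarith

theorem exists_phiTri_eq {z : ℝ} (hz : z ∈ Set.Icc (0 : ℝ) (27 / 256)) :
    ∃ u ∈ Set.Icc (0 : ℝ) (1 / 4), phiTri u = z := by
  have hc : ContinuousOn phiTri (Set.Icc 0 (1 / 4)) := by
    unfold phiTri
    fun_prop
  refine intermediate_value_Icc (by norm_num) hc ?_
  rwa [show phiTri 0 = 0 by norm_num [phiTri], show phiTri (1 / 4) = 27 / 256 by norm_num [phiTri]]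

theorem thetaTri_mem {z : ℝ} (hz : z ∈ Set.Icc (0 : ℝ) (27 / 256)) :
    thetaTri z ∈ Set.Icc (0 : ℝ) (1 / 4) :=
  Function.invFunOn_mem (exists_phiTri_eq hz)

theorem phiTri_thetaTri {z : ℝ} (hz : z ∈ Set.Icc (0 : ℝ) (27 / 256)) :
    phiTri (thetaTri z) = z :=
  Function.invFunOn_eq (exists_phiTri_eq hz)

/-- The generating function of edge-rooted triangulations in the single variable `z = x u³`. -/
noncomputable def triSeries (z : ℝ) : ℝ :=
  z / 2 + thetaTri z * (1 - 2 * thetaTri z) / 2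

theorem T0_eq_triSeries (x u : ℝ) : T0 x u = triSeries (x * u ^ 3) := rfl

theorem triSeries_nonneg {z : ℝ} (hz : z ∈ Set.Icc (0 : ℝ) (27 / 256)) : 0 ≤ triSeries z := by
  obtain ⟨h0, h1⟩ := thetaTri_mem hz
  have h := mul_nonneg h0 (by linarith : 0 ≤ 1 - 2 * thetaTri z)
  unfold triSeries
  linarith [hz.1]

theorem triSeries_le {z : ℝ} (hz : z ∈ Set.Icc (0 : ℝ) (27 / 256)) :
    triSeries z ≤ 59 / 512 := by
  unfold triSeries
  nlinarith [hz.2, sq_nonneg (thetaTri z - 1 / 4)]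

theorem triSeries_sub_mem {y z : ℝ} (hy : y ∈ Set.Icc (0 : ℝ) (27 / 256))
    (hz : z ∈ Set.Icc (0 : ℝ) (27 / 256)) (hyz : y ≤ z) :
    triSeries z - triSeries y ∈ Set.Icc 0 (3 / 2 * (z - y)) := by
  have hy' := thetaTri_mem hy
  have hz' := thetaTri_mem hz
  have hle : thetaTri y ≤ thetaTri z := by
    rwa [← strictMonoOn_phiTri.le_iff_le hy' hz', phiTri_thetaTri hy, phiTri_thetaTri hz]
  have h := phiTri_sub_le hy'.1 hle hz'.2
  rw [phiTri_thetaTri hy, phiTri_thetaTri hz] at h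
  have h' : 0 ≤ (thetaTri z - thetaTri y) * (1 - 2 * (thetaTri y + thetaTri z)) :=
    mul_nonneg (sub_nonneg.2 hle) (by linarith [hy'.2, hz'.2])
  unfold triSeries
  constructor <;> nlinarith

theorem continuousOn_triSeries : ContinuousOn triSeries (Set.Icc 0 (27 / 256)) := by
  refine LipschitzOnWith.continuousOn (K := 3 / 2) (LipschitzOnWith.of_dist_le_mul ?_)
  intro y hy z hz
  rw [Real.dist_eq, Real.dist_eq]
  push_cast
  rcases le_total y z with h | h
  · obtain ⟨h0, h1⟩ := triSeries_sub_mem hy hz h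
    rw [abs_sub_comm, abs_of_nonneg h0, abs_sub_comm, abs_of_nonneg (sub_nonneg.2 h)]
    exact h1
  · obtain ⟨h0, h1⟩ := triSeries_sub_mem hz hy h
    rw [abs_of_nonneg h0, abs_of_nonneg (sub_nonneg.2 h)]
    exact h1

theorem mul_cube_mem {x t F : ℝ} (hx : 0 ≤ x) (hxt : x * t ^ 3 ≤ 27 / 256)
    (hF : F ∈ Set.Icc 1 t) : x * F ^ 3 ∈ Set.Icc (0 : ℝ) (27 / 256) := by
  have hF0 : 0 ≤ F := zero_le_one.trans hF.1
  exact ⟨by positivity, le_trans (by gcongr; exact hF.2) hxt⟩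

theorem T0_sub_le {x t F G : ℝ} (hx : 0 ≤ x) (hxt : x * t ^ 3 ≤ 27 / 256)
    (hF : F ∈ Set.Icc 1 t) (hG : G ∈ Set.Icc 1 t) (hFG : F ≤ G) :
    T0 x G - T0 x F ≤ G - F := by
  have hF0 : 0 ≤ F := zero_le_one.trans hF.1
  have hG0 : 0 ≤ G := zero_le_one.trans hG.1
  have h := (triSeries_sub_mem (mul_cube_mem hx hxt hF) (mul_cube_mem hx hxt hG)
    (by gcongr)).2
  have h3 : x * (G ^ 2 + G * F + F ^ 2) ≤ 81 / 256 := by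
    have : G ^ 2 + G * F + F ^ 2 ≤ 3 * G ^ 3 := by
      nlinarith [mul_nonneg hG0 (sub_nonneg.2 hFG), mul_nonneg hF0 (sub_nonneg.2 hFG),
        mul_nonneg (sq_nonneg G) (sub_nonneg.2 hG.1)]
    nlinarith [(mul_cube_mem hx hxt hG).2, mul_le_mul_of_nonneg_left this hx]
  rw [T0_eq_triSeries, T0_eq_triSeries]
  nlinarith [mul_le_mul_of_nonneg_left h3 (sub_nonneg.2 hFG)]

theorem le_of_fixed_points {x t F G : ℝ} (hx : 0 ≤ x) (hxt : x * t ^ 3 ≤ 27 / 256)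
    (ht : t ≤ 11 / 10) (hF : F ∈ Set.Icc 1 t) (hG : G ∈ Set.Icc 1 t)
    (hFe : F = Real.exp ((x ^ 3 / 6) * (F + T0 x F) ^ 9))
    (hGe : G = Real.exp ((x ^ 3 / 6) * (G + T0 x G) ^ 9)) : G ≤ F := by
  by_contra! hFG
  have hF0 : 0 ≤ F := zero_le_one.trans hF.1
  have hT := T0_sub_le hx hxt hF hG hFG.le
  have hmF := mul_cube_mem hx hxt hF
  have hmG := mul_cube_mem hx hxt hG
  have hmono : T0 x F ≤ T0 x G :=
    sub_nonneg.1 (triSeries_sub_mem hmF hmG (by gcongr)).1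
  have hTF : 0 ≤ T0 x F := triSeries_nonneg hmF
  have hTG : T0 x G ≤ 59 / 512 := triSeries_le hmG
  have hx1 : x ≤ 27 / 256 := by
    have h1 : (1 : ℝ) ≤ F ^ 3 := one_le_pow₀ hF.1
    nlinarith [hmF.2]
  set A := F + T0 x F with hA
  set B := G + T0 x G with hB
  have hA0 : 0 ≤ A := by linarith
  have hAB : A ≤ B := by linarith
  have hB1 : B ≤ 5 / 4 := by linarith [hG.2]
  have hpow : B ^ 9 - A ^ 9 ≤ 9 * (5 / 4) ^ 8 * (B - A) := by
    have hconv := abs_pow_sub_pow_le B A 9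
    rw [abs_of_nonneg (sub_nonneg.2 (pow_le_pow_left₀ hA0 hAB 9)),
      abs_of_nonneg (sub_nonneg.2 hAB), abs_of_nonneg hA0, abs_of_nonneg (hA0.trans hAB),
      max_eq_left hAB] at hconv
    have h8 : B ^ 8 ≤ (5 / 4) ^ 8 := pow_le_pow_left₀ (hA0.trans hAB) hB1 8
    norm_num at hconv
    nlinarith [mul_le_mul_of_nonneg_left h8 (sub_nonneg.2 hAB)]
  have hx3 : x ^ 3 / 6 ≤ 1 / 1000 := by
    have := pow_le_pow_left₀ hx hx1 3
    norm_num at this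
    linarith
  have hexp : x ^ 3 / 6 * B ^ 9 - x ^ 3 / 6 * A ^ 9 ≤ (G - F) / 2 := by
    have h1 := mul_le_mul_of_nonneg_left hpow (by positivity : 0 ≤ x ^ 3 / 6)
    have h2 := mul_le_mul_of_nonneg_right hx3
      (by linarith : 0 ≤ 9 * (5 / 4) ^ 8 * (B - A))
    linarith
  have hFG' : G * (1 - (G - F) / 2) ≤ F := by
    have hFq : F = G * Real.exp (x ^ 3 / 6 * A ^ 9 - x ^ 3 / 6 * B ^ 9) := by
      rw [Real.exp_sub, ← hFe, ← hGe, mul_div_cancel₀ _ (hF0.trans_lt hFG).ne']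
    have h := Real.add_one_le_exp (x ^ 3 / 6 * A ^ 9 - x ^ 3 / 6 * B ^ 9)
    have h' : 1 - (G - F) / 2 ≤ Real.exp (x ^ 3 / 6 * A ^ 9 - x ^ 3 / 6 * B ^ 9) := by
      linarith
    nth_rewrite 2 [hFq]
    exact mul_le_mul_of_nonneg_left h' (hF0.trans hFG.le)
  nlinarith [hG.2]

theorem exists_fixed_point {x t : ℝ} (hx : 0 ≤ x) (hxt : x * t ^ 3 ≤ 27 / 256) (ht : 1 ≤ t)
    (hte : t = Real.exp ((27 ^ 3 / (6 * 256 ^ 3)) * (1 + 59 / (512 * t)) ^ 9)) :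
    ∃ F ∈ Set.Icc 1 t, F = Real.exp ((x ^ 3 / 6) * (F + T0 x F) ^ 9) := by
  have hmem : ∀ F ∈ Set.Icc 1 t, x * F ^ 3 ∈ Set.Icc (0 : ℝ) (27 / 256) :=
    fun F hF => mul_cube_mem hx hxt hF
  have hT : ContinuousOn (T0 x) (Set.Icc 1 t) :=
    continuousOn_triSeries.comp (f := fun F : ℝ => x * F ^ 3) (by fun_prop) hmem
  have hc : ContinuousOn (fun F => F - Real.exp ((x ^ 3 / 6) * (F + T0 x F) ^ 9))
      (Set.Icc 1 t) := by
    fun_prop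
  have h1 : (1 : ℝ) ≤ Real.exp ((x ^ 3 / 6) * (1 + T0 x 1) ^ 9) := by
    have h0 : 0 ≤ T0 x 1 := triSeries_nonneg (hmem 1 ⟨le_rfl, ht⟩)
    exact Real.one_le_exp (by positivity)
  have h2 : Real.exp ((x ^ 3 / 6) * (t + T0 x t) ^ 9) ≤ t := by
    have hm := hmem t ⟨ht, le_rfl⟩
    have h0 : 0 ≤ T0 x t := triSeries_nonneg hm
    have h59 : T0 x t ≤ 59 / 512 := triSeries_le hm
    have ht0 : 0 < t := zero_lt_one.trans_le ht
    nth_rewrite 3 [hte]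
    refine Real.exp_le_exp.2 ?_
    calc x ^ 3 / 6 * (t + T0 x t) ^ 9 ≤ x ^ 3 / 6 * (t + 59 / 512) ^ 9 := by gcongr
      _ = (x * t ^ 3) ^ 3 / 6 * (1 + 59 / (512 * t)) ^ 9 := by
        rw [show t + 59 / 512 = t * (1 + 59 / (512 * t)) by field_simp]
        ring
      _ ≤ (27 / 256) ^ 3 / 6 * (1 + 59 / (512 * t)) ^ 9 := by
        gcongr
      _ = _ := by ring
  obtain ⟨F, hF, hF0⟩ := intermediate_value_Icc ht hc
    (show (0 : ℝ) ∈ Set.Icc _ _ from ⟨sub_nonpos.2 h1, sub_nonneg.2 h2⟩)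
  exact ⟨F, hF, sub_eq_zero.1 hF0⟩

theorem mem_Icc_of_critical_eq {t : ℝ} (ht : 0 < t)
    (hte : t = Real.exp ((27 ^ 3 / (6 * 256 ^ 3)) * (1 + 59 / (512 * t)) ^ 9)) :
    t ∈ Set.Icc (1 : ℝ) (11 / 10) := by
  have h1 : 1 ≤ t := by
    rw [hte]
    exact Real.one_le_exp (by positivity)
  refine ⟨h1, ?_⟩
  have hd : 59 / (512 * t) ≤ 59 / 512 := by
    gcongr
    linarith
  have hy : 27 ^ 3 / (6 * 256 ^ 3) * (1 + 59 / (512 * t)) ^ 9 ≤ 1 / 11 :=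
    calc _ ≤ 27 ^ 3 / (6 * 256 ^ 3) * (1 + 59 / 512 : ℝ) ^ 9 := by gcongr
      _ ≤ 1 / 11 := by norm_num
  have hn := Real.add_one_le_exp (-(1 / 11 : ℝ))
  have hm : Real.exp (-(1 / 11 : ℝ)) * Real.exp (1 / 11) = 1 := by
    rw [← Real.exp_add]
    norm_num
  have he := Real.exp_le_exp.2 hy
  rw [← hte] at he
  nlinarith [Real.exp_pos (1 / 11 : ℝ)]

theorem unique_F_fixed_point
    (tstar : ℝ) (htpos : 0 < tstar)
    (heq : tstar = Real.exp ((27 ^ 3 / (6 * 256 ^ 3)) * (1 + 59 / (512 * tstar)) ^ 9))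
    (huniq : ∀ s : ℝ, 0 < s →
      s = Real.exp ((27 ^ 3 / (6 * 256 ^ 3)) * (1 + 59 / (512 * s)) ^ 9) → s = tstar) :
    ∀ x : ℝ, 0 < x → x ≤ 27 / (256 * tstar ^ 3) →
      (∃! F : ℝ, F ∈ Set.Icc 1 tstar ∧
          F = Real.exp ((x ^ 3 / 6) * (F + T0 x F) ^ 9)) ∧
      ∀ F ∈ Set.Icc 1 tstar,
        F = Real.exp ((x ^ 3 / 6) * (F + T0 x F) ^ 9) → x * F ^ 3 ≤ 27 / 256 := by
  intro x hx hxr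
  obtain ⟨h1, h11⟩ := mem_Icc_of_critical_eq htpos heq
  have hxt : x * tstar ^ 3 ≤ 27 / 256 := by
    rw [le_div_iff₀ (by positivity)] at hxr
    linarith
  refine ⟨?_, fun F hF _ => (mul_cube_mem hx.le hxt hF).2⟩
  obtain ⟨F, hF, hFe⟩ := exists_fixed_point hx.le hxt h1 heq
  exact ⟨F, ⟨hF, hFe⟩, fun G ⟨hG, hGe⟩ =>
    le_antisymm (le_of_fixed_points hx.le hxt h11 hF hG hFe hGe)
      (le_of_fixed_points hx.le hxt h11 hG hF hGe hFe)⟩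
end

section
/- Let θ : [0, 27/256] → [0, 1/4] be the inverse of the restriction of φ(u) = u(1−u)³ to [0,1/4]. Then there exists a real power series Σ_{n≥1} a_n x^n whose radius of convergence is exactly 27/256 and whose sum equals θ(x) for all x ∈ [0, 27/256). -/
open Polynomial Filter Topology

lemma phiTri_injOn : Set.InjOn phiTri (Set.Icc 0 (1 / 4)) := by
  intro u hu v hv h
  obtain ⟨-, hu⟩ := hu
  obtain ⟨-, hv⟩ := hv
  unfold phiTri at h
  by_contra hne
  have hsq : 0 < (u - v) ^ 2 := by
    have := sub_ne_zero.mpr hne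
    positivity
  have hfac : (u - v) * (((1 - u) + (1 - v)) * ((1 - u) ^ 2 + (1 - v) ^ 2)
      - ((1 - u) ^ 2 + (1 - u) * (1 - v) + (1 - v) ^ 2)) = 0 := by
    linear_combination h
  rcases mul_eq_zero.mp hfac with h0 | h0
  · exact hne (sub_eq_zero.mp h0)
  · have : 0 ≤ (1 / 2 - u - v) * ((1 - u) ^ 2 + (1 - v) ^ 2) :=
      mul_nonneg (by linarith) (by positivity)
    nlinarith

lemma thetaTri_phiTri {u : ℝ} (hu : u ∈ Set.Icc (0 : ℝ) (1 / 4)) :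
    thetaTri (phiTri u) = u :=
  phiTri_injOn.leftInvOn_invFunOn hu

lemma Polynomial.coeff_mul_nonneg {p q : ℝ[X]} (hp : ∀ n, 0 ≤ p.coeff n)
    (hq : ∀ n, 0 ≤ q.coeff n) (n : ℕ) : 0 ≤ (p * q).coeff n := by
  rw [coeff_mul]
  exact Finset.sum_nonneg fun i _ => mul_nonneg (hp _) (hq _)

lemma Polynomial.coeff_X_nonneg (n : ℕ) : 0 ≤ (X : ℝ[X]).coeff n := by
  rw [coeff_X]
  split_ifs <;> simp

lemma Polynomial.coeff_add_nonneg {p q : ℝ[X]} (hp : ∀ n, 0 ≤ p.coeff n)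
    (hq : ∀ n, 0 ≤ q.coeff n) (n : ℕ) : 0 ≤ (p + q).coeff n := by
  rw [coeff_add]
  exact add_nonneg (hp n) (hq n)

/-- The iterates of `v ↦ 1 + X v⁴`, which converge to the generating function of the
Fuss-Catalan numbers of order four. -/
noncomputable def fussIter : ℕ → ℝ[X]
  | 0 => 1
  | k + 1 => 1 + X * fussIter k ^ 4

lemma fussIter_coeff_nonneg (k n : ℕ) : 0 ≤ (fussIter k).coeff n := by
  have h_one (n : ℕ) : 0 ≤ (1 : ℝ[X]).coeff n := by
    rw [coeff_one]
    split_ifs <;> simp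
  induction k generalizing n with
  | zero => exact h_one n
  | succ k ih =>
    rw [fussIter, show fussIter k ^ 4 =
      (fussIter k * fussIter k) * (fussIter k * fussIter k) by ring]
    exact coeff_add_nonneg h_one (coeff_mul_nonneg coeff_X_nonneg
      (coeff_mul_nonneg (coeff_mul_nonneg ih ih) (coeff_mul_nonneg ih ih))) n

lemma fussIter_sub_coeff_nonneg (k n : ℕ) :
    0 ≤ (fussIter (k + 1) - fussIter k).coeff n := by
  induction k generalizing n with
  | zero =>
    simpa [fussIter] using coeff_X_nonneg n
  | succ k ih =>
    have hA := fussIter_coeff_nonneg (k + 1)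
    have hB := fussIter_coeff_nonneg k
    have : fussIter (k + 1 + 1) - fussIter (k + 1) = X * ((fussIter (k + 1) - fussIter k) *
        ((fussIter (k + 1) + fussIter k) *
          (fussIter (k + 1) * fussIter (k + 1) + fussIter k * fussIter k))) := by
      linear_combination fussIter.eq_2 (k + 1) - fussIter.eq_2 k
    rw [this]
    exact coeff_mul_nonneg coeff_X_nonneg (coeff_mul_nonneg ih (coeff_mul_nonneg
      (coeff_add_nonneg hA hB)
      (coeff_add_nonneg (coeff_mul_nonneg hA hA) (coeff_mul_nonneg hB hB)))) n

lemma X_pow_dvd_fussIter_sub (k : ℕ) : X ^ (k + 1) ∣ fussIter (k + 1) - fussIter k := by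
  induction k with
  | zero => simp [fussIter]
  | succ k ih =>
    have : fussIter (k + 1 + 1) - fussIter (k + 1) =
        X * (fussIter (k + 1) ^ 4 - fussIter k ^ 4) := by
      linear_combination fussIter.eq_2 (k + 1) - fussIter.eq_2 k
    rw [this, pow_succ']
    exact mul_dvd_mul_left X (ih.trans (sub_dvd_pow_sub_pow _ _ 4))

/-- Polynomial approximations of the series `θ = X v³`. -/
noncomputable def thetaIter (k : ℕ) : ℝ[X] := X * fussIter k ^ 3

lemma thetaIter_coeff_nonneg (k n : ℕ) : 0 ≤ (thetaIter k).coeff n := by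
  have h := fussIter_coeff_nonneg k
  rw [thetaIter, show fussIter k ^ 3 = fussIter k * (fussIter k * fussIter k) by ring]
  exact coeff_mul_nonneg coeff_X_nonneg (coeff_mul_nonneg h (coeff_mul_nonneg h h)) n

lemma thetaIter_coeff_mono (n : ℕ) : Monotone fun k => (thetaIter k).coeff n := by
  refine monotone_nat_of_le_succ fun k => ?_
  have hA := fussIter_coeff_nonneg (k + 1)
  have hB := fussIter_coeff_nonneg k
  rw [← sub_nonneg, ← coeff_sub, show thetaIter (k + 1) - thetaIter k =
    X * ((fussIter (k + 1) - fussIter k) * (fussIter (k + 1) * fussIter (k + 1) +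
      (fussIter (k + 1) * fussIter k + fussIter k * fussIter k))) by
    simp only [thetaIter]; ring]
  exact coeff_mul_nonneg coeff_X_nonneg (coeff_mul_nonneg (fussIter_sub_coeff_nonneg k)
    (coeff_add_nonneg (coeff_mul_nonneg hA hA)
      (coeff_add_nonneg (coeff_mul_nonneg hA hB) (coeff_mul_nonneg hB hB)))) n

lemma thetaIter_coeff_eq {n k : ℕ} (h : n ≤ k) :
    (thetaIter k).coeff n = (thetaIter n).coeff n := by
  induction k, h using Nat.le_induction with
  | base => rfl
  | succ k hk ih =>
    rw [← ih, ← sub_eq_zero, ← coeff_sub, thetaIter, thetaIter, ← mul_sub]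
    exact X_pow_dvd_iff.mp (((X_pow_dvd_fussIter_sub k).trans
      (sub_dvd_pow_sub_pow _ _ 3)).mul_left X) n (by omega)

/-- The coefficients of the power series of `θ`. -/
noncomputable def thetaCoeff (n : ℕ) : ℝ := (thetaIter n).coeff n

lemma thetaCoeff_nonneg (n : ℕ) : 0 ≤ thetaCoeff n := thetaIter_coeff_nonneg n n

lemma thetaIter_coeff_le_thetaCoeff (k n : ℕ) : (thetaIter k).coeff n ≤ thetaCoeff n := by
  rcases le_total n k with h | h
  · exact (thetaIter_coeff_eq h).le
  · exact thetaIter_coeff_mono n h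

lemma sum_thetaCoeff_le_eval_thetaIter {x : ℝ} (hx : 0 ≤ x) (k : ℕ) :
    ∑ n ∈ Finset.range k, thetaCoeff n * x ^ n ≤ (thetaIter k).eval x := by
  have hsum : ∑ n ∈ Finset.range k, thetaCoeff n * x ^ n =
      ∑ n ∈ Finset.range k, (thetaIter k).coeff n * x ^ n :=
    Finset.sum_congr rfl fun n hn => by
      rw [thetaCoeff, thetaIter_coeff_eq (Finset.mem_range.mp hn).le]
  rw [hsum, eval_eq_sum_range' (lt_max_of_lt_right (Nat.lt_succ_self _) :
    (thetaIter k).natDegree < max k ((thetaIter k).natDegree + 1))]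
  exact Finset.sum_le_sum_of_subset_of_nonneg (Finset.range_mono (le_max_left _ _))
    fun n _ _ => mul_nonneg (thetaIter_coeff_nonneg k n) (pow_nonneg hx n)

lemma eval_thetaIter_le_sum_thetaCoeff {x : ℝ} (hx : 0 ≤ x) (k : ℕ) :
    (thetaIter k).eval x ≤
      ∑ n ∈ Finset.range ((thetaIter k).natDegree + 1), thetaCoeff n * x ^ n := by
  rw [eval_eq_sum_range]
  exact Finset.sum_le_sum fun n _ =>
    mul_le_mul_of_nonneg_right (thetaIter_coeff_le_thetaCoeff k n) (pow_nonneg hx n)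

lemma hasSum_thetaCoeff_of_tendsto {x s : ℝ} (hx : 0 ≤ x)
    (h : Tendsto (fun k => (thetaIter k).eval x) atTop (𝓝 s))
    (hs : ∀ k, (thetaIter k).eval x ≤ s) :
    HasSum (fun n => thetaCoeff n * x ^ n) s := by
  have hnn (n : ℕ) : 0 ≤ thetaCoeff n * x ^ n :=
    mul_nonneg (thetaCoeff_nonneg n) (pow_nonneg hx n)
  have hsum : Summable fun n => thetaCoeff n * x ^ n :=
    summable_of_sum_range_le hnn fun k => (sum_thetaCoeff_le_eval_thetaIter hx k).trans (hs k)
  have hle : ∑' n, thetaCoeff n * x ^ n ≤ s :=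
    hsum.tsum_le_of_sum_range_le fun k => (sum_thetaCoeff_le_eval_thetaIter hx k).trans (hs k)
  have hge : s ≤ ∑' n, thetaCoeff n * x ^ n :=
    le_of_tendsto' h fun k => (eval_thetaIter_le_sum_thetaCoeff hx k).trans
      (hsum.sum_le_tsum _ fun n _ => hnn n)
  exact hle.antisymm hge ▸ hsum.hasSum

lemma eval_fussIter_succ (x : ℝ) (k : ℕ) :
    (fussIter (k + 1)).eval x = 1 + x * (fussIter k).eval x ^ 4 := by
  simp [fussIter]

lemma eval_thetaIter (x : ℝ) (k : ℕ) :
    (thetaIter k).eval x = x * (fussIter k).eval x ^ 3 := by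
  simp [thetaIter]

lemma one_le_eval_fussIter {x : ℝ} (hx : 0 ≤ x) (k : ℕ) : 1 ≤ (fussIter k).eval x := by
  cases k with
  | zero => simp [fussIter]
  | succ k =>
    rw [eval_fussIter_succ]
    have : 0 ≤ x * (fussIter k).eval x ^ 4 := by positivity
    linarith

lemma eval_fussIter_mono {x : ℝ} (hx : 0 ≤ x) : Monotone fun k => (fussIter k).eval x := by
  refine monotone_nat_of_le_succ fun k => ?_
  rw [← sub_nonneg, ← eval_sub, eval_eq_sum_range]
  exact Finset.sum_nonneg fun n _ =>
    mul_nonneg (fussIter_sub_coeff_nonneg k n) (pow_nonneg hx n)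

lemma eval_fussIter_le {x : ℝ} (hx : 0 ≤ x) (hxR : x ≤ 27 / 256) (k : ℕ) :
    (fussIter k).eval x ≤ 4 / 3 := by
  induction k with
  | zero => norm_num [fussIter]
  | succ k ih =>
    have h1 := one_le_eval_fussIter hx k
    rw [eval_fussIter_succ]
    calc 1 + x * (fussIter k).eval x ^ 4 ≤ 1 + 27 / 256 * (4 / 3) ^ 4 := by gcongr
      _ = 4 / 3 := by norm_num

lemma hasSum_thetaTri {x : ℝ} (hx : 0 ≤ x) (hxR : x ≤ 27 / 256) :
    HasSum (fun n => thetaCoeff n * x ^ n) (thetaTri x) := by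
  have hbdd : BddAbove (Set.range fun k => (fussIter k).eval x) :=
    ⟨4 / 3, Set.forall_mem_range.mpr (eval_fussIter_le hx hxR)⟩
  set S := ⨆ k, (fussIter k).eval x
  have hlim : Tendsto (fun k => (fussIter k).eval x) atTop (𝓝 S) :=
    tendsto_atTop_ciSup (eval_fussIter_mono hx) hbdd
  have hle (k : ℕ) : (fussIter k).eval x ≤ S := le_ciSup hbdd k
  have hS1 : 1 ≤ S := (one_le_eval_fussIter hx 0).trans (hle 0)
  have hS : S ≤ 4 / 3 := ciSup_le (eval_fussIter_le hx hxR)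
  have hfix : S = 1 + x * S ^ 4 := by
    refine tendsto_nhds_unique (hlim.comp (tendsto_add_atTop_nat 1)) ?_
    simpa only [Function.comp_def, eval_fussIter_succ] using
      ((hlim.pow 4).const_mul x).const_add 1
  have hmem : x * S ^ 3 ∈ Set.Icc (0 : ℝ) (1 / 4) := by
    refine ⟨by positivity, ?_⟩
    nlinarith
  have hphi : phiTri (x * S ^ 3) = x := by
    have h1 : S * (1 - x * S ^ 3) = 1 := by linear_combination hfix
    calc phiTri (x * S ^ 3) = x * (S * (1 - x * S ^ 3)) ^ 3 := by unfold phiTri; ring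
      _ = x := by rw [h1]; ring
  have htheta : thetaTri x = x * S ^ 3 := by
    conv_lhs => rw [← hphi]
    exact thetaTri_phiTri hmem
  rw [htheta]
  refine hasSum_thetaCoeff_of_tendsto hx ?_ fun k => ?_
  · simpa only [eval_thetaIter] using (hlim.pow 3).const_mul x
  · rw [eval_thetaIter]
    have := one_le_eval_fussIter hx k
    have := hle k
    gcongr

lemma not_summable_thetaCoeff {y : ℝ} (hy : 27 / 256 < y) :
    ¬ Summable fun n => thetaCoeff n * y ^ n := by
  intro hsum
  have hy0 : 0 < y := by linarith
  have hbound (k : ℕ) : y * (fussIter k).eval y ≤ ∑' n, thetaCoeff n * y ^ n := by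
    have h1 := one_le_eval_fussIter hy0.le k
    calc y * (fussIter k).eval y ≤ y * (fussIter k).eval y ^ 3 := by
          gcongr
          exact le_self_pow₀ h1 (by norm_num)
      _ = (thetaIter k).eval y := (eval_thetaIter y k).symm
      _ ≤ _ := (eval_thetaIter_le_sum_thetaCoeff hy0.le k).trans
          (hsum.sum_le_tsum _ fun n _ => mul_nonneg (thetaCoeff_nonneg n) (pow_nonneg hy0.le n))
  have hgrow (k : ℕ) : k * (y - 27 / 256) ≤ (fussIter k).eval y := by
    induction k with
    | zero => simp [fussIter]
    | succ k ih =>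
      have h1 := one_le_eval_fussIter hy0.le k
      rw [eval_fussIter_succ]
      set g := (fussIter k).eval y
      have h4 : y - 27 / 256 ≤ (y - 27 / 256) * g ^ 4 :=
        le_mul_of_one_le_right (by linarith) (one_le_pow₀ h1)
      have htan : 0 ≤ 27 / 256 * g ^ 4 + 1 - g := by
        have : 27 / 256 * g ^ 4 + 1 - g = (3 * g - 4) ^ 2 * (3 * g ^ 2 + 8 * g + 16) / 256 := by
          ring
        rw [this]
        positivity
      push_cast
      linarith
  obtain ⟨k, hk⟩ := exists_nat_gt ((∑' n, thetaCoeff n * y ^ n) / (y * (y - 27 / 256)))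
  rw [div_lt_iff₀ (mul_pos hy0 (by linarith))] at hk
  have := mul_le_mul_of_nonneg_left (hgrow k) hy0.le
  linarith [hbound k]

/-- There is a power series `∑_{n≥1} aₙ xⁿ` with radius of convergence exactly `27/256`
whose sum is `θ(x)` for `x ∈ [0, 27/256)`. -/
theorem theta_powerSeries :
    ∃ a : ℕ → ℝ,
      a 0 = 0 ∧
      (∀ x : ℝ, |x| < 27 / 256 → Summable fun n => a n * x ^ n) ∧
      (∀ x : ℝ, 27 / 256 < |x| → ¬ Summable fun n => a n * x ^ n) ∧
      ∀ x ∈ Set.Ico (0 : ℝ) (27 / 256), HasSum (fun n => a n * x ^ n) (thetaTri x) := by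
  refine ⟨thetaCoeff, by simp [thetaCoeff, thetaIter], fun x hx => ?_, fun x hx hsum => ?_,
    fun x hx => hasSum_thetaTri hx.1 hx.2.le⟩
  · refine Summable.of_norm ?_
    simpa only [norm_mul, norm_pow, Real.norm_eq_abs, abs_of_nonneg (thetaCoeff_nonneg _)] using
      (hasSum_thetaTri (abs_nonneg x) hx.le).summable
  · have habs := hsum.abs
    simp only [abs_mul, abs_pow, abs_of_nonneg (thetaCoeff_nonneg _)] at habs
    exact not_summable_thetaCoeff hx habs
end

section
/- Let x > 0 and let I ⊆ (0,∞) be an open interval. Suppose L : I → [0, 1/4) is differentiable and satisfies L(y)·(1 − L(y))³ = x·y³ for all y ∈ I. Then the function y ↦ x·y³/2 + L(y)·(1 − 2L(y))/2 is differentiable on I with derivative (3·x·y²/2) · (1 + 1/(1 − L(y))²) at every y ∈ I. -/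
theorem deriv_T0_formula (x a b : ℝ) (hx : 0 < x) (hab : 0 < a)
    (L : ℝ → ℝ)
    (hrange : ∀ y ∈ Set.Ioo a b, L y ∈ Set.Ico (0 : ℝ) (1 / 4))
    (hdiff : ∀ y ∈ Set.Ioo a b, DifferentiableAt ℝ L y)
    (halg : ∀ y ∈ Set.Ioo a b, L y * (1 - L y) ^ 3 = x * y ^ 3) :
    ∀ y ∈ Set.Ioo a b,
      HasDerivAt (fun y => x * y ^ 3 / 2 + L y * (1 - 2 * L y) / 2)
        ((3 * x * y ^ 2 / 2) * (1 + 1 / (1 - L y) ^ 2)) y := by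
  intro y hy
  have hL := (hdiff y hy).hasDerivAt
  have hcube : HasDerivAt (fun z => x * z ^ 3) (3 * x * y ^ 2) y :=
    ((hasDerivAt_pow 3 y).const_mul x).congr_deriv (by push_cast; ring)
  have hlhs : HasDerivAt (fun z => L z * (1 - L z) ^ 3)
      (deriv L y * (1 - L y) ^ 2 * (1 - 4 * L y)) y :=
    (hL.fun_mul ((hL.const_sub 1).fun_pow 3)).congr_deriv (by push_cast; ring)
  have heq : (fun z => x * z ^ 3) =ᶠ[nhds y] fun z => L z * (1 - L z) ^ 3 := by
    filter_upwards [isOpen_Ioo.mem_nhds hy] with z hz using (halg z hz).symm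
  have hkey : deriv L y * (1 - L y) ^ 2 * (1 - 4 * L y) = 3 * x * y ^ 2 :=
    (hlhs.congr_of_eventuallyEq heq).unique hcube
  have hne : 1 - L y ≠ 0 := by linarith [(hrange y hy).2]
  refine ((hcube.div_const 2).fun_add
    ((hL.fun_mul ((hL.const_mul 2).const_sub 1)).div_const 2)).congr_deriv ?_
  rw [← hkey]
  field_simp
  ring
end
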